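/- There is an absolute constant C > 0 such that for every natural number k there exists a measurable function v : {−1, 1} × ℝ → ℝ with v(a, b) = 0 whenever b ∉ [−2, 3] and |v(a, b)| ≤ C·(k³ + 1) for all (a, b), such that for every real z with |z| ≤ 1: (1/2) · Σ_{a ∈ {−1,1}} ∫_{−3}^{3} (1/6) · v(a, b) · σ₁(a·z + b) db = z^k. In other words, with a uniform on {−1,1} and b uniform on [−3,3] independent, E_{a,b}[v(a,b) · σ₁(az + b)] = z^k for all |z| ≤ 1. -/

import Mathlib

noncomputable section

/-- The smoothed absolute-value activation: `σ₁(t) = t²` for `|t| < 1` and `σ₁(t) = 2|t| − 1`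
for `|t| ≥ 1`. -/
def σ1 (t : ℝ) : ℝ := if |t| < 1 then t ^ 2 else 2 * |t| - 1

lemma sig_eq (t : ℝ) : σ1 t = 2 * |t| - 1 + (max 0 (1 - |t|)) ^ 2 := by
  unfold σ1
  split_ifs with h
  · rw [max_eq_right (by linarith), ← sq_abs t]; ring
  · rw [max_eq_left (by linarith)]; ring

lemma sig_cont : Continuous σ1 := by
  have : σ1 = fun t => 2 * |t| - 1 + (max 0 (1 - |t|)) ^ 2 := funext sig_eq
  rw [this]; fun_prop

lemma sig_mid {t : ℝ} (h1 : -1 ≤ t) (h2 : t ≤ 1) : σ1 t = t ^ 2 := by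
  have : |t| ≤ 1 := abs_le.2 ⟨h1, h2⟩
  rw [sig_eq, max_eq_right (by linarith), ← sq_abs t]; ring

lemma sig_right {t : ℝ} (h1 : 1 ≤ t) : σ1 t = 2 * t - 1 := by
  have : |t| = t := abs_of_nonneg (by linarith)
  rw [sig_eq, this, max_eq_left (by linarith)]; ring

lemma sig_left {t : ℝ} (h1 : t ≤ -1) : σ1 t = -2 * t - 1 := by
  have : |t| = -t := abs_of_nonpos (by linarith)
  rw [sig_eq, this, max_eq_left (by linarith)]; ring

lemma int_of_deriv {f F F' : ℝ → ℝ} {a b : ℝ} (hab : a ≤ b)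
    (hf : ∀ x, a ≤ x → x ≤ b → f x = F' x)
    (hF : ∀ x, HasDerivAt F (F' x) x) (hc : Continuous F') :
    ∫ x in a..b, f x = F b - F a := by
  have : ∫ x in a..b, f x = ∫ x in a..b, F' x := by
    apply intervalIntegral.integral_congr
    intro x hx
    rw [Set.uIcc_of_le hab] at hx
    exact hf x hx.1 hx.2
  rw [this]
  exact intervalIntegral.integral_eq_sub_of_hasDerivAt (fun x _ => hF x)
    (hc.intervalIntegrable _ _)

/-- constant piece -/
lemma piece_const {z : ℝ} (h1 : -1 ≤ z) (h2 : z ≤ 1) :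
    ∫ b in (-2 : ℝ)..2, σ1 (z + b) = 2 * z ^ 2 + 14 / 3 := by
  have hc : Continuous fun b => σ1 (z + b) := sig_cont.comp (by fun_prop)
  rw [← intervalIntegral.integral_add_adjacent_intervals (b := -1 - z)
    (hc.intervalIntegrable _ _) (hc.intervalIntegrable _ _),
    ← intervalIntegral.integral_add_adjacent_intervals (a := -1 - z) (b := 1 - z)
    (hc.intervalIntegrable _ _) (hc.intervalIntegrable _ _)]
  rw [int_of_deriv (F := fun b => -(z + b) ^ 2 - b) (F' := fun b => -2 * (z + b) - 1) (by linarith)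
      (fun x _ _ => sig_left (by linarith)) ?_ (by fun_prop),
    int_of_deriv (F := fun b => (z + b) ^ 3 / 3) (F' := fun b => (z + b) ^ 2) (by linarith)
      (fun x _ _ => sig_mid (by linarith) (by linarith)) ?_ (by fun_prop),
    int_of_deriv (F := fun b => (z + b) ^ 2 - b) (F' := fun b => 2 * (z + b) - 1) (by linarith)
      (fun x _ _ => sig_right (by linarith)) ?_ (by fun_prop)]
  · ring
  · intro x
    have h := (((hasDerivAt_id x).const_add z).pow 2).sub (hasDerivAt_id x)
    exact (h.congr_deriv (by simp))
  · intro x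
    have h := (((hasDerivAt_id x).const_add z).pow 3).div_const 3
    exact (h.congr_deriv (by simp))
  · intro x
    have h := (((hasDerivAt_id x).const_add z).pow 2).neg.sub (hasDerivAt_id x)
    exact (h.congr_deriv (by simp))

/-- linear piece -/
lemma piece_lin {z : ℝ} (h1 : -1 ≤ z) (p q : ℝ) :
    ∫ b in (2 : ℝ)..3, (p + q * (b - 5 / 2)) * σ1 (z + b) = p * (2 * z + 4) + q / 6 := by
  rw [int_of_deriv
      (F := fun b => (p - q * (5 / 2)) * (2 * z - 1) * b + (2 * (p - q * (5 / 2)) + q * (2 * z - 1)) * (b ^ 2 / 2)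
        + 2 * q * (b ^ 3 / 3))
      (F' := fun b => (p + q * (b - 5 / 2)) * (2 * (z + b) - 1)) (by norm_num)
      (fun x _ _ => by rw [sig_right (by linarith)]) ?_ (by fun_prop)]
  · ring
  · intro x
    have h := (((hasDerivAt_id x).const_mul ((p - q * (5 / 2)) * (2 * z - 1))).add
      ((((hasDerivAt_id x).pow 2).div_const 2).const_mul
        (2 * (p - q * (5 / 2)) + q * (2 * z - 1)))).add
      ((((hasDerivAt_id x).pow 3).div_const 3).const_mul (2 * q))
    exact (h.congr_deriv (by simp; ring))

/-- third derivative of the monomial -/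
def gk (k : ℕ) (x : ℝ) : ℝ :=
  (k : ℝ) * (((k - 1 : ℕ) : ℝ) * (((k - 1 - 1 : ℕ) : ℝ) * x ^ (k - 1 - 1 - 1)))

lemma gk_cont (k : ℕ) : Continuous (gk k) := by unfold gk; fun_prop

lemma piece_g {z : ℝ} (h1 : -1 ≤ z) (h2 : z ≤ 1) (k : ℕ) :
    ∫ b in (0 : ℝ)..2, gk k (1 - b) * σ1 (z + b) =
      -2 * z ^ k + (k : ℝ) * ((k - 1 : ℕ) : ℝ) * z ^ 2 + 2 * k * z + 2
        - (k : ℝ) * ((k - 1 : ℕ) : ℝ) * (-1) ^ (k - 1 - 1) * (3 + 2 * z)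
        - 2 * k * (-1) ^ (k - 1) := by
  have e := intervalIntegral.integral_comp_sub_left (a := (0 : ℝ)) (b := 2)
    (fun x => gk k x * σ1 (z + (1 - x))) 1
  simp only [sub_sub_cancel] at e
  rw [e]
  have hc : Continuous fun x => gk k x * σ1 (z + (1 - x)) :=
    (gk_cont k).mul (sig_cont.comp (by fun_prop))
  have hg := gk_cont k
  have d0 : ∀ x : ℝ, HasDerivAt (fun x : ℝ => x ^ k) (k * x ^ (k - 1)) x := hasDerivAt_pow k
  have d1 : ∀ x : ℝ, HasDerivAt (fun x : ℝ => (k : ℝ) * x ^ (k - 1))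
      (k * (((k - 1 : ℕ) : ℝ) * x ^ (k - 1 - 1))) x :=
    fun x => (hasDerivAt_pow (k - 1) x).const_mul _
  have d2 : ∀ x : ℝ, HasDerivAt (fun x : ℝ => (k : ℝ) * (((k - 1 : ℕ) : ℝ) * x ^ (k - 1 - 1)))
      (gk k x) x :=
    fun x => ((hasDerivAt_pow (k - 1 - 1) x).const_mul _).const_mul _
  have dl : ∀ x : ℝ, HasDerivAt (fun x : ℝ => z - x) (-1) x :=
    fun x => (hasDerivAt_id x).const_sub z
  have dQ : ∀ x : ℝ, HasDerivAt (fun x : ℝ =>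
      (k : ℝ) * (((k - 1 : ℕ) : ℝ) * x ^ (k - 1 - 1)) * (1 + 2 * (z - x))
      + 2 * ((k : ℝ) * x ^ (k - 1))) (gk k x * (1 + 2 * (z - x))) x := by
    intro x
    have h := ((d2 x).mul (((dl x).const_mul 2).const_add 1)).add ((d1 x).const_mul 2)
    exact h.congr_deriv (by ring)
  have dP : ∀ x : ℝ, HasDerivAt (fun x : ℝ =>
      (k : ℝ) * (((k - 1 : ℕ) : ℝ) * x ^ (k - 1 - 1)) * (z - x) ^ 2
      + 2 * ((k : ℝ) * x ^ (k - 1) * (z - x)) + 2 * x ^ k) (gk k x * (z - x) ^ 2) x := by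
    intro x
    have h := (((d2 x).mul ((dl x).pow 2)).add (((d1 x).mul (dl x)).const_mul 2)).add
      ((d0 x).const_mul 2)
    exact h.congr_deriv (by simp; ring)
  rw [show (1 : ℝ) - 2 = -1 by norm_num, show (1 : ℝ) - 0 = 1 by norm_num,
    ← intervalIntegral.integral_add_adjacent_intervals (b := z)
    (hc.intervalIntegrable _ _) (hc.intervalIntegrable _ _)]
  rw [int_of_deriv (F' := fun x => gk k x * (1 + 2 * (z - x))) h1
      (fun x _ _ => by rw [sig_right (by linarith)]; ring) dQ (by fun_prop),
    int_of_deriv (F' := fun x => gk k x * (1 + 2 * (z - x)) + gk k x * (z - x) ^ 2) h2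
      (fun x _ _ => by rw [sig_mid (by linarith) (by linarith)]; ring)
      (fun x => (dQ x).add (dP x)) (by fun_prop)]
  simp only [Pi.add_apply, one_pow]
  ring

lemma int_ind {f : ℝ → ℝ} {c d : ℝ} (h1 : -3 ≤ c) (h2 : c ≤ d) (h3 : d ≤ 3) :
    ∫ b in (-3 : ℝ)..3, (Set.Icc c d).indicator f b = ∫ b in c..d, f b := by
  rw [intervalIntegral.integral_of_le (by norm_num), intervalIntegral.integral_of_le h2,
    ← MeasureTheory.integral_Icc_eq_integral_Ioc, ← MeasureTheory.integral_Icc_eq_integral_Ioc,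
    MeasureTheory.setIntegral_indicator measurableSet_Icc,
    Set.inter_eq_right.2 (Set.Icc_subset_Icc h1 h3)]

lemma ii_ind {f : ℝ → ℝ} (hf : Continuous f) (c d : ℝ) :
    IntervalIntegrable ((Set.Icc c d).indicator f) MeasureTheory.volume (-3) 3 := by
  rw [intervalIntegrable_iff_integrableOn_Ioc_of_le (by norm_num)]
  exact (((intervalIntegrable_iff_integrableOn_Ioc_of_le (by norm_num)).1
    (hf.intervalIntegrable _ _)).indicator measurableSet_Icc)

def wk (k : ℕ) (s p q b : ℝ) : ℝ :=
  (Set.Icc (-2 : ℝ) 2).indicator (fun _ => s) b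
    + (Set.Icc (0 : ℝ) 2).indicator (fun b => -6 * gk k (1 - b)) b
    + (Set.Icc (2 : ℝ) 3).indicator (fun b => p + q * (b - 5 / 2)) b

lemma wk_meas (k : ℕ) (s p q : ℝ) : Measurable (wk k s p q) := by
  have hg := gk_cont k
  unfold wk
  refine ((measurable_const.indicator measurableSet_Icc).add
    (Measurable.indicator (Continuous.measurable (by fun_prop)) measurableSet_Icc)).add
    (Measurable.indicator (Continuous.measurable (by fun_prop)) measurableSet_Icc)

lemma wk_int {z : ℝ} (h1 : -1 ≤ z) (h2 : z ≤ 1) (k : ℕ) (s p q : ℝ) :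
    ∫ b in (-3 : ℝ)..3, (1 / 6 : ℝ) * wk k s p q b * σ1 (1 * z + b) =
      1 / 6 * (s * (2 * z ^ 2 + 14 / 3) + -6 * (-2 * z ^ k + (k : ℝ) * ((k - 1 : ℕ) : ℝ) * z ^ 2
        + 2 * k * z + 2 - (k : ℝ) * ((k - 1 : ℕ) : ℝ) * (-1) ^ (k - 1 - 1) * (3 + 2 * z)
        - 2 * k * (-1) ^ (k - 1)) + (p * (2 * z + 4) + q / 6)) := by
  have hg := gk_cont k
  have hs := sig_cont
  have e : ∀ b, (1 / 6 : ℝ) * wk k s p q b * σ1 (1 * z + b) = 1 / 6 *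
      ((Set.Icc (-2 : ℝ) 2).indicator (fun b => s * σ1 (z + b)) b
      + (Set.Icc (0 : ℝ) 2).indicator (fun b => -6 * (gk k (1 - b) * σ1 (z + b))) b
      + (Set.Icc (2 : ℝ) 3).indicator (fun b => (p + q * (b - 5 / 2)) * σ1 (z + b)) b) := by
    intro b
    simp only [wk, Set.indicator_apply, one_mul]
    split_ifs <;> ring
  simp only [e]
  have i1 := ii_ind (f := fun b => s * σ1 (z + b)) (by fun_prop) (-2) 2
  have i2 := ii_ind (f := fun b => -6 * (gk k (1 - b) * σ1 (z + b))) (by fun_prop) 0 2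
  have i3 := ii_ind (f := fun b => (p + q * (b - 5 / 2)) * σ1 (z + b)) (by fun_prop) 2 3
  rw [intervalIntegral.integral_const_mul, intervalIntegral.integral_add (i1.add i2) i3,
    intervalIntegral.integral_add i1 i2,
    int_ind (by norm_num) (by norm_num) (by norm_num),
    int_ind (by norm_num) (by norm_num) (by norm_num),
    int_ind (by norm_num) (by norm_num) (by norm_num),
    intervalIntegral.integral_const_mul, intervalIntegral.integral_const_mul,
    piece_const h1 h2, piece_g h1 h2, piece_lin h1]

lemma gk_bound (k : ℕ) {x : ℝ} (hx : |x| ≤ 1) : |gk k x| ≤ (k : ℝ) ^ 3 := by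
  unfold gk
  rw [abs_mul, abs_mul, abs_mul, abs_pow, Nat.abs_cast, Nat.abs_cast, Nat.abs_cast]
  have a1 : ((k - 1 : ℕ) : ℝ) ≤ k := by exact_mod_cast Nat.sub_le _ _
  have a2 : ((k - 1 - 1 : ℕ) : ℝ) ≤ k := by
    exact_mod_cast (Nat.sub_le _ _).trans (Nat.sub_le _ _)
  have a3 : |x| ^ (k - 1 - 1 - 1) ≤ 1 := pow_le_one₀ (abs_nonneg _) hx
  calc (k : ℝ) * (((k - 1 : ℕ) : ℝ) * (((k - 1 - 1 : ℕ) : ℝ) * |x| ^ (k - 1 - 1 - 1)))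
      ≤ k * (k * (k * 1)) := by gcongr
    _ = (k : ℝ) ^ 3 := by ring

lemma wk_bound (k : ℕ) {s p q B : ℝ} (hs : |s| ≤ B) (hp : |p| ≤ B) (hq : |q| ≤ B)
    (hB : (k : ℝ) ^ 3 ≤ B) (b : ℝ) : |wk k s p q b| ≤ 10 * B := by
  have hB0 : 0 ≤ B := (abs_nonneg _).trans hs
  have t1 : |(Set.Icc (-2 : ℝ) 2).indicator (fun _ => s) b| ≤ B := by
    rw [Set.indicator_apply]; split_ifs
    · exact hs
    · simpa using hB0
  have t2 : |(Set.Icc (0 : ℝ) 2).indicator (fun b => -6 * gk k (1 - b)) b| ≤ 6 * B := by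
    rw [Set.indicator_apply]; split_ifs with h
    · have := gk_bound k (x := 1 - b) (abs_le.2 ⟨by linarith [h.2], by linarith [h.1]⟩)
      rw [abs_mul]; norm_num; linarith
    · simpa using hB0
  have t3 : |(Set.Icc (2 : ℝ) 3).indicator (fun b => p + q * (b - 5 / 2)) b| ≤ 2 * B := by
    rw [Set.indicator_apply]; split_ifs with h
    · have hb : |b - 5 / 2| ≤ 1 := abs_le.2 ⟨by linarith [h.1], by linarith [h.2]⟩
      have := abs_add_le p (q * (b - 5 / 2))
      rw [abs_mul] at this
      have := mul_le_mul hq hb (abs_nonneg _) hB0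
      linarith
    · simpa using hB0
  unfold wk
  refine (abs_add_three _ _ _).trans ?_
  linarith

/-- **Random-feature expression of monomials (Lemma `lem:transform_activation`).**
There is an absolute constant `C > 0` such that for every `k` there is a measurable
`v : {−1,1} × ℝ → ℝ`, vanishing for `b ∉ [−2,3]` and bounded by `C (k³ + 1)`, with
`E_{a,b}[v(a,b) σ₁(az + b)] = z^k` for all `|z| ≤ 1`, where `a` is uniform on `{−1,1}` and
`b` uniform on `[−3,3]`, independent. -/
theorem random_feature_monomial :
    ∃ C : ℝ, 0 < C ∧
      ∀ k : ℕ, ∃ v : ℝ → ℝ → ℝ,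
        Measurable (Function.uncurry v) ∧
        (∀ a b : ℝ, b ∉ Set.Icc (-2 : ℝ) 3 → v a b = 0) ∧
        (∀ a b : ℝ, |v a b| ≤ C * ((k : ℝ) ^ 3 + 1)) ∧
        ∀ z : ℝ, |z| ≤ 1 →
          (1 / 2 : ℝ) *
              ((∫ b in (-3 : ℝ)..3, (1 / 6 : ℝ) * v 1 b * σ1 (1 * z + b)) +
                ∫ b in (-3 : ℝ)..3, (1 / 6 : ℝ) * v (-1) b * σ1 ((-1) * z + b)) =
            z ^ k := by

  refine ⟨10000, by norm_num, fun k => ?_⟩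
  set c : ℝ := (k : ℝ) * ((k - 1 : ℕ) : ℝ) with hc
  set e : ℝ := (-1) ^ (k - 1 - 1) with he
  set e' : ℝ := (-1) ^ (k - 1) with he'
  have he1 : |e| = 1 := by simp [he]
  have he1' : |e'| = 1 := by simp [he']
  set s : ℝ := 3 * c with hs
  set p : ℝ := 6 * k - 6 * (c * e) with hp
  set q : ℝ := -6 * (-12 + 18 * (c * e) + 12 * (k * e') + 14 * c + 4 * p) with hq
  have k3 : (k : ℝ) ≤ (k : ℝ) ^ 3 := by exact_mod_cast Nat.le_self_pow (by norm_num) k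
  have k23 : (k : ℝ) ^ 2 ≤ (k : ℝ) ^ 3 := by
    rcases Nat.eq_zero_or_pos k with h | h
    · simp [h]
    · exact_mod_cast Nat.pow_le_pow_right h (by norm_num)
  have c0 : 0 ≤ c := by positivity
  have k0 : (0 : ℝ) ≤ k := by positivity
  have c3 : c ≤ (k : ℝ) ^ 3 := by
    have a1 : ((k - 1 : ℕ) : ℝ) ≤ k := by exact_mod_cast Nat.sub_le _ _
    have : c ≤ (k : ℝ) * k := by rw [hc]; gcongr
    nlinarith
  have ce : |c * e| ≤ (k : ℝ) ^ 3 := by rw [abs_mul, he1, mul_one, abs_of_nonneg c0]; exact c3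
  have ke : |k * e'| ≤ (k : ℝ) ^ 3 := by rw [abs_mul, he1', mul_one, abs_of_nonneg k0]; exact k3
  have ce' := abs_le.1 ce
  have ke' := abs_le.1 ke
  have hw := wk_bound k (s := s) (p := p) (q := q) (B := 1000 * ((k : ℝ) ^ 3 + 1))
    (abs_le.2 ⟨by linarith, by linarith⟩) (abs_le.2 ⟨by linarith, by linarith⟩)
    (abs_le.2 ⟨by linarith, by linarith⟩) (by linarith)
  refine ⟨fun a b => if a = 1 then wk k s p q b else 0, ?_, ?_, ?_, ?_⟩
  · exact Measurable.ite (measurableSet_eq_fun measurable_fst measurable_const)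
      ((wk_meas k s p q).comp measurable_snd) measurable_const
  · intro a b hb
    have n1 : b ∉ Set.Icc (-2 : ℝ) 2 := fun h => hb ⟨h.1, by linarith [h.2]⟩
    have n2 : b ∉ Set.Icc (0 : ℝ) 2 := fun h => hb ⟨by linarith [h.1], by linarith [h.2]⟩
    have n3 : b ∉ Set.Icc (2 : ℝ) 3 := fun h => hb ⟨by linarith [h.1], h.2⟩
    simp only [wk, Set.indicator_of_notMem n1, Set.indicator_of_notMem n2,
      Set.indicator_of_notMem n3]
    simp
  · intro a b
    dsimp only
    split_ifs
    · linarith [hw b]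
    · simp; positivity
  · intro z hz
    have hz' := abs_le.1 hz
    have n : ¬ ((-1 : ℝ) = 1) := by norm_num
    simp only [if_true, if_neg n, mul_zero, zero_mul, intervalIntegral.integral_zero, add_zero]
    rw [wk_int hz'.1 hz'.2, ← hc, ← he, ← he', hq, hp, hs]
    ring
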